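/- Let G be a topological group acting continuously on a locally compact Hausdorff topological space X. Then the action is proper if and only if for every compact subset K ⊆ X the set Ret(K) := {g ∈ G : (g·K) ∩ K ≠ ∅} is compact. -/

import Mathlib

open Pointwise

/-- **Properness via return sets.** A continuous action of a topological group `G` on
a locally compact Hausdorff space `X` is proper if and only if for every compact
`K ⊆ X` the set `Ret(K) = {g : G | g•K ∩ K ≠ ∅}` is compact. -/
theorem stmt_6 {G X : Type*} [Group G] [TopologicalSpace G] [IsTopologicalGroup G]
    [TopologicalSpace X] [LocallyCompactSpace X] [T2Space X]
    [MulAction G X] [ContinuousSMul G X] :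
    ProperSMul G X ↔
      ∀ K : Set X, IsCompact K → IsCompact {g : G | ((g • K) ∩ K).Nonempty} := by
  constructor
  · intro h K hK
    have h1 := (h.isProperMap_smul_pair.isCompact_preimage (hK.prod hK)).image continuous_fst
    convert! h1 using 1
    ext g
    constructor
    · rintro ⟨_, ⟨k, hk, rfl⟩, hk'⟩
      exact ⟨(g, k), ⟨hk', hk⟩, rfl⟩
    · rintro ⟨⟨g', k⟩, ⟨hk', hk⟩, rfl⟩
      exact ⟨g' • k, ⟨k, hk, rfl⟩, hk'⟩
  · intro h
    rw [properSMul_iff_continuousSMul_ultrafilter_tendsto_t2]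
    refine ⟨inferInstance, fun U x₁ x₂ hU => ?_⟩
    obtain ⟨K₁, hK₁, hx₁⟩ := exists_compact_mem_nhds x₁
    obtain ⟨K₂, hK₂, hx₂⟩ := exists_compact_mem_nhds x₂
    have hmem : {g : G | ((g • (K₁ ∪ K₂)) ∩ (K₁ ∪ K₂)).Nonempty} ∈ U.map Prod.fst := by
      have h1 := hU (prod_mem_nhds hx₁ hx₂)
      rw [Ultrafilter.mem_map]
      refine Filter.mem_of_superset (Filter.mem_map.1 h1) ?_
      rintro ⟨g, x⟩ ⟨h1, h2⟩
      exact ⟨g • x, ⟨x, Or.inr h2, rfl⟩, Or.inl h1⟩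
    obtain ⟨g, -, hg⟩ := (h _ (hK₁.union hK₂)).ultrafilter_le_nhds (U.map Prod.fst)
      (Filter.le_principal_iff.2 hmem)
    exact ⟨g, hg⟩
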